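/- arXiv:1806.07333 — 6 statements merged into one kernel-verified Lean document; each statement's English description precedes it below -/
import Mathlib

section
/- Let ρ0, ρ1, ρ2 ≥ 0 be reals and K ≥ 2 an integer; set γ_K = (1/K)·min{ρ1,ρ2} and λ_K = ρ0 + ρ1 + ρ2 − 2γ_K. Define R_MR(M) on [0, ρ0+ρ1+ρ2] by: R_MR(M) = ρ0+ρ1+ρ2−2M for M ∈ [0, γ_K); R_MR(M) = ρ0+ρ1+ρ2−γ_K−M for M ∈ [γ_K, λ_K); R_MR(M) = (1/2)(ρ0+ρ1+ρ2−M) for M ∈ [λ_K, ρ0+ρ1+ρ2]. Define R_lb(M) = max{ρ0+ρ1+ρ2−2M, ρ0+(1/2)(ρ1+ρ2+max{ρ1,ρ2})−M, (1/2)(ρ0+ρ1+ρ2−M)}. Then R_MR(M) = R_lb(M) for all M ∈ [0, γ_K] ∪ [λ_K, ρ0+ρ1+ρ2], and R_MR(M) − R_lb(M) ≤ (1/2 − 1/K)·min{ρ1,ρ2} for all M ∈ [0, ρ0+ρ1+ρ2]. -/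
theorem stmt7 (ρ0 ρ1 ρ2 : ℝ) (hρ0 : 0 ≤ ρ0) (hρ1 : 0 ≤ ρ1) (hρ2 : 0 ≤ ρ2)
    (K : ℕ) (hK : 2 ≤ K)
    (γK lamK : ℝ)
    (hγ : γK = (1 / (K : ℝ)) * min ρ1 ρ2)
    (hlam : lamK = ρ0 + ρ1 + ρ2 - 2 * γK)
    (RMR Rlb : ℝ → ℝ)
    (hRMR : ∀ M, RMR M =
      if M < γK then ρ0 + ρ1 + ρ2 - 2 * M
      else if M < lamK then ρ0 + ρ1 + ρ2 - γK - M
      else (1/2) * (ρ0 + ρ1 + ρ2 - M))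
    (hRlb : ∀ M, Rlb M =
      max (ρ0 + ρ1 + ρ2 - 2 * M)
        (max (ρ0 + (1/2) * (ρ1 + ρ2 + max ρ1 ρ2) - M)
             ((1/2) * (ρ0 + ρ1 + ρ2 - M)))) :
    (∀ M ∈ Set.Icc (0:ℝ) γK ∪ Set.Icc lamK (ρ0 + ρ1 + ρ2), RMR M = Rlb M) ∧
    (∀ M ∈ Set.Icc (0:ℝ) (ρ0 + ρ1 + ρ2),
      RMR M - Rlb M ≤ (1/2 - 1/(K : ℝ)) * min ρ1 ρ2) := by
  have hK' : (2 : ℝ) ≤ K := by exact_mod_cast hK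
  have hm : 0 ≤ min ρ1 ρ2 := le_min hρ1 hρ2
  have hγ_nonneg : 0 ≤ γK := by rw [hγ]; positivity
  have hγ_le : γK ≤ (1 / 2) * min ρ1 ρ2 := by
    rw [hγ]
    gcongr
  have hsum : min ρ1 ρ2 + max ρ1 ρ2 = ρ1 + ρ2 := min_add_max ρ1 ρ2
  have hle : min ρ1 ρ2 ≤ max ρ1 ρ2 := min_le_max
  have hgap : (1 / 2 - 1 / (K : ℝ)) * min ρ1 ρ2 = (1 / 2) * min ρ1 ρ2 - γK := by
    rw [hγ]; ring
  constructor
  · rintro M (⟨hM0, hM1⟩ | ⟨hM0, hM1⟩)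
    · have hRlb_eq : Rlb M = ρ0 + ρ1 + ρ2 - 2 * M := by
        rw [hRlb]
        exact max_eq_left (max_le (by linarith) (by linarith))
      rw [hRlb_eq, hRMR]
      split_ifs <;> linarith
    · have hRlb_eq : Rlb M = (1 / 2) * (ρ0 + ρ1 + ρ2 - M) := by
        rw [hRlb, max_eq_right (a := ρ0 + (1 / 2) * (ρ1 + ρ2 + max ρ1 ρ2) - M) (by linarith)]
        exact max_eq_right (by linarith)
      rw [hRlb_eq, hRMR]
      split_ifs <;> linarith
  · rintro M -
    have h₁ : ρ0 + ρ1 + ρ2 - 2 * M ≤ Rlb M := by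
      rw [hRlb]; exact le_max_left _ _
    have h₂ : ρ0 + (1 / 2) * (ρ1 + ρ2 + max ρ1 ρ2) - M ≤ Rlb M := by
      rw [hRlb]; exact (le_max_left _ _).trans (le_max_right _ _)
    have h₃ : (1 / 2) * (ρ0 + ρ1 + ρ2 - M) ≤ Rlb M := by
      rw [hRlb]; exact (le_max_right _ _).trans (le_max_right _ _)
    rw [hgap, hRMR]
    split_ifs <;> linarith
end

section
/- Let ρ0, ρ1, ρ2 ≥ 0 be reals and K ≥ 2 an integer; set γ_K = (1/K)·min{ρ1,ρ2}, λ_K = ρ0+ρ1+ρ2−2γ_K, and γ̄_K = ρ0 + 2γ_K. Define R̄_MR(M) on [0, ρ0+ρ1+ρ2] by: R̄_MR(M) = ρ0 + (1−1/2^K)(ρ1+ρ2) − (3/2 − 2/2^K)M for M ∈ [0, 2γ_K); R̄_MR(M) = ρ0 + (1−1/2^K)(ρ1+ρ2) − (1−4/2^K)γ_K − M for M ∈ [2γ_K, γ̄_K); R̄_MR(M) = (1−1/2^K)(ρ0+ρ1+ρ2−M) − (1−2/2^K)γ_K for M ∈ [γ̄_K, λ_K); R̄_MR(M) = (1/2)(ρ0+ρ1+ρ2−M)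 for M ∈ [λ_K, ρ0+ρ1+ρ2]. Define R̄_lb(M) = max{ρ0 + (1−1/2^K)(ρ1+ρ2) − 2(1−1/2^K)M, (3/4)ρ0 + (1/2)(ρ1+ρ2) + (1/4)max{ρ1,ρ2} − (3/4)M, ρ0 + (3/4)(ρ1+ρ2) − M, (1/2)(ρ0+ρ1+ρ2−M)}. Then R̄_MR(M) = R̄_lb(M) for all M ∈ [λ_K, ρ0+ρ1+ρ2], and R̄_MR(M) − R̄_lb(M) ≤ (1/4 − 1/2^K)(ρ1+ρ2) for all M ∈ [0, ρ0+ρ1+ρ2]. -/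
theorem add_two_le_two_pow {K : ℕ} (hK : 2 ≤ K) : K + 2 ≤ 2 ^ K := by
  induction K, hK using Nat.le_induction with
  | base => norm_num
  | succ n _ ih => rw [pow_succ]; omega


theorem stmt8 (ρ0 ρ1 ρ2 : ℝ) (hρ0 : 0 ≤ ρ0) (hρ1 : 0 ≤ ρ1) (hρ2 : 0 ≤ ρ2)
    (K : ℕ) (hK : 2 ≤ K)
    (γK lamK γbarK : ℝ)
    (hγ : γK = (1 / (K : ℝ)) * min ρ1 ρ2)
    (hlam : lamK = ρ0 + ρ1 + ρ2 - 2 * γK)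
    (hγbar : γbarK = ρ0 + 2 * γK)
    (RMRbar Rlbbar : ℝ → ℝ)
    (hRMRbar : ∀ M, RMRbar M =
      if M < 2 * γK then ρ0 + (1 - 1/(2:ℝ)^K) * (ρ1 + ρ2) - (3/2 - 2/(2:ℝ)^K) * M
      else if M < γbarK then ρ0 + (1 - 1/(2:ℝ)^K) * (ρ1 + ρ2) - (1 - 4/(2:ℝ)^K) * γK - M
      else if M < lamK then (1 - 1/(2:ℝ)^K) * (ρ0 + ρ1 + ρ2 - M) - (1 - 2/(2:ℝ)^K) * γK
      else (1/2) * (ρ0 + ρ1 + ρ2 - M))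
    (hRlbbar : ∀ M, Rlbbar M =
      max (ρ0 + (1 - 1/(2:ℝ)^K) * (ρ1 + ρ2) - 2 * (1 - 1/(2:ℝ)^K) * M)
        (max ((3/4) * ρ0 + (1/2) * (ρ1 + ρ2) + (1/4) * max ρ1 ρ2 - (3/4) * M)
          (max (ρ0 + (3/4) * (ρ1 + ρ2) - M)
               ((1/2) * (ρ0 + ρ1 + ρ2 - M))))) :
    (∀ M ∈ Set.Icc lamK (ρ0 + ρ1 + ρ2), RMRbar M = Rlbbar M) ∧
    (∀ M ∈ Set.Icc (0:ℝ) (ρ0 + ρ1 + ρ2),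
      RMRbar M - Rlbbar M ≤ (1/4 - 1/(2:ℝ)^K) * (ρ1 + ρ2)) := by
  have hKR : (2 : ℝ) ≤ K := by exact_mod_cast hK
  have hpow : (K : ℝ) + 2 ≤ 2 ^ K := by exact_mod_cast add_two_le_two_pow hK
  have hpos : (0 : ℝ) < 2 ^ K := by positivity
  have he : 0 < 1 / (2 : ℝ) ^ K := by positivity
  have heK : ((K : ℝ) + 2) * (1 / (2 : ℝ) ^ K) ≤ 1 := by
    rw [mul_one_div, div_le_one hpos]; exact hpow
  have h2 : 2 / (2 : ℝ) ^ K = 2 * (1 / (2 : ℝ) ^ K) := by ring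
  have h4 : 4 / (2 : ℝ) ^ K = 4 * (1 / (2 : ℝ) ^ K) := by ring
  rw [h2, h4] at hRMRbar
  generalize 1 / (2 : ℝ) ^ K = e at *
  have he4 : e ≤ 1 / 4 := by nlinarith
  have hmin : min ρ1 ρ2 = K * γK := by rw [hγ]; field_simp
  have hmax : max ρ1 ρ2 = ρ1 + ρ2 - K * γK := by
    rw [← hmin, ← min_add_max ρ1 ρ2]; ring
  have hm1 : K * γK ≤ ρ1 := hmin ▸ min_le_left _ _
  have hm2 : K * γK ≤ ρ2 := hmin ▸ min_le_right _ _
  have hg : 0 ≤ γK := by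
    rw [hγ]; exact mul_nonneg (by positivity) (le_min hρ1 hρ2)
  have hg2 : 2 * γK ≤ K * γK := mul_le_mul_of_nonneg_right hKR hg
  rw [hmax] at hRlbbar
  have heq : ∀ M ∈ Set.Icc lamK (ρ0 + ρ1 + ρ2), RMRbar M = Rlbbar M := by
    rintro M ⟨hM, -⟩
    rw [hRMRbar, hRlbbar, if_neg (by linarith), if_neg (by linarith), if_neg (by linarith)]
    have hM' : ρ0 + (ρ1 + ρ2) / 2 ≤ M := by linarith
    rw [max_eq_right (a := ρ0 + 3 / 4 * (ρ1 + ρ2) - M) (by linarith),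
      max_eq_right (a := 3 / 4 * ρ0 + 1 / 2 * (ρ1 + ρ2) + 1 / 4 * (ρ1 + ρ2 - K * γK) - 3 / 4 * M)
        (b := 1 / 2 * (ρ0 + ρ1 + ρ2 - M)) (by linarith), max_eq_right]
    nlinarith [mul_nonneg (by linarith : 0 ≤ 3 / 2 - 2 * e) (sub_nonneg.2 hM'),
      mul_nonneg (by linarith : 0 ≤ 1 - 2 * e) hρ0]
  refine ⟨heq, ?_⟩
  rintro M ⟨hM0, hM⟩
  have he4' : 0 ≤ 1 / 4 - e := by linarith
  have hbound : 0 ≤ (1 / 4 - e) * (ρ1 + ρ2) := mul_nonneg he4' (by linarith)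
  rcases le_or_gt lamK M with hl | hl
  · rw [heq M ⟨hl, hM⟩, sub_self]; exact hbound
  have hB : 3 / 4 * ρ0 + 1 / 2 * (ρ1 + ρ2) + 1 / 4 * (ρ1 + ρ2 - K * γK) - 3 / 4 * M
      ≤ Rlbbar M := by
    rw [hRlbbar]; exact (le_max_left _ _).trans (le_max_right _ _)
  have hC : ρ0 + 3 / 4 * (ρ1 + ρ2) - M ≤ Rlbbar M := by
    rw [hRlbbar]
    exact ((le_max_left _ _).trans (le_max_right _ _)).trans (le_max_right _ _)
  rw [hRMRbar]
  split_ifs with h1 h3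
  · nlinarith [mul_nonneg he4' hM0]
  · nlinarith [mul_nonneg he4' hg]
  · rcases le_or_gt (e * (M - ρ0)) ((1 - 2 * e) * γK) with hx | hx
    · nlinarith
    · have hkey : (1 / 4 * K - 1 + 2 * e) * γK ≤ (1 / 4 - e) * (M - ρ0) := by
        refine le_of_mul_le_mul_left ?_ he
        nlinarith [mul_le_mul_of_nonneg_left hx.le he4',
          mul_nonneg hg (sub_nonneg.2 heK)]
      nlinarith
end

section
/- Let X1, X2, U be finitely-valued random variables forming a Markov chain X1 − U − X2, and let K ≥ 2 be an integer. Set ρ0 = I((X1,X2); U), ρ1 = H(X1|U), ρ2 = H(X2|U), and γ_K = (1/K)·min{ρ1,ρ2}. Define R_MR(M) on [0, H(X1,X2)] by: R_MR(M) = ρ0+ρ1+ρ2−2M for M ∈ [0, γ_K); R_MR(M) = ρ0+ρ1+ρ2−γ_K−M for M ∈ [γ_K, ρ0+ρ1+ρ2−2γ_K); R_MR(M) = (1/2)(ρ0+ρ1+ρ2−M) for M ∈ [ρ0+ρ1+ρ2−2γ_K, ρ0+ρ1+ρ2]. Define R_lb(M) = max{H(X1,X2)−2M, (1/2)(H(X1,X2)+max{H(X1),H(X2)})−M,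 (1/2)(H(X1,X2)−M)}. Then R_MR(M) = R_lb(M) for all M ∈ [0, γ_K] ∪ [H(X1,X2)−2γ_K, H(X1,X2)], and R_MR(M) − R_lb(M) ≤ (1/2)·min{H(X1|X2), H(X2|X1)} − (1/K)·min{H(X1|U), H(X2|U)} for all M ∈ [0, H(X1,X2)]. -/
open Real

/-- Distribution (pmf) of the random variable `X` under the pmf `p` on the sample space. -/
noncomputable def distOf {Ω A : Type*} [Fintype Ω] [DecidableEq A]
    (p : Ω → ℝ) (X : Ω → A) (a : A) : ℝ :=
  ∑ ω ∈ Finset.univ.filter (fun ω => X ω = a), p ω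

/-- Shannon entropy of the random variable `X` under the pmf `p`. -/
noncomputable def ent {Ω A : Type*} [Fintype Ω] [Fintype A] [DecidableEq A]
    (p : Ω → ℝ) (X : Ω → A) : ℝ :=
  ∑ a, Real.negMulLog (distOf p X a)

/-- Conditional entropy `H(X | Y) = H(X, Y) - H(Y)`. -/
noncomputable def condEnt {Ω A B : Type*} [Fintype Ω] [Fintype A] [Fintype B]
    [DecidableEq A] [DecidableEq B] (p : Ω → ℝ) (X : Ω → A) (Y : Ω → B) : ℝ :=
  ent p (fun ω => (X ω, Y ω)) - ent p Y

/-- Mutual information `I(X; Y) = H(X) + H(Y) - H(X, Y)`. -/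
noncomputable def mutInfo {Ω A B : Type*} [Fintype Ω] [Fintype A] [Fintype B]
    [DecidableEq A] [DecidableEq B] (p : Ω → ℝ) (X : Ω → A) (Y : Ω → B) : ℝ :=
  ent p X + ent p Y - ent p (fun ω => (X ω, Y ω))

/-- `p` is a probability mass function. -/
def IsPMF {Ω : Type*} [Fintype Ω] (p : Ω → ℝ) : Prop :=
  (∀ ω, 0 ≤ p ω) ∧ ∑ ω, p ω = 1

/-- `X1 − U − X2` is a Markov chain: `X1` and `X2` are conditionally independent given `U`. -/
def MarkovTriple {Ω A B C : Type*} [Fintype Ω] [DecidableEq A] [DecidableEq B] [DecidableEq C]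
    (p : Ω → ℝ) (X1 : Ω → A) (X2 : Ω → B) (U : Ω → C) : Prop :=
  ∀ x1 x2 u,
    distOf p (fun ω => (X1 ω, X2 ω, U ω)) (x1, x2, u) * distOf p U u =
    distOf p (fun ω => (X1 ω, U ω)) (x1, u) * distOf p (fun ω => (X2 ω, U ω)) (x2, u)

theorem distOf_eq_sum_ite {Ω A : Type*} [Fintype Ω] [DecidableEq A]
    (p : Ω → ℝ) (X : Ω → A) (a : A) :
    distOf p X a = ∑ ω, if X ω = a then p ω else 0 :=
  Finset.sum_filter _ _

theorem distOf_nonneg {Ω A : Type*} [Fintype Ω] [DecidableEq A]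
    {p : Ω → ℝ} (hp : ∀ ω, 0 ≤ p ω) (X : Ω → A) (a : A) : 0 ≤ distOf p X a :=
  Finset.sum_nonneg fun ω _ => hp ω

theorem distOf_apply_pos {Ω A : Type*} [Fintype Ω] [DecidableEq A]
    {p : Ω → ℝ} (hp : ∀ ω, 0 ≤ p ω) (X : Ω → A) {ω : Ω} (hω : 0 < p ω) :
    0 < distOf p X (X ω) :=
  hω.trans_le <| Finset.single_le_sum (f := p) (fun i _ => hp i) (by simp)

theorem sum_mul_comp_eq_sum_distOf {Ω A : Type*} [Fintype Ω] [Fintype A] [DecidableEq A]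
    (p : Ω → ℝ) (X : Ω → A) (g : A → ℝ) :
    ∑ ω, p ω * g (X ω) = ∑ a, distOf p X a * g a := by
  simp only [distOf_eq_sum_ite, Finset.sum_mul]
  rw [Finset.sum_comm]
  simp [ite_mul]

theorem sum_distOf_fst {Ω A C : Type*} [Fintype Ω] [Fintype A] [DecidableEq A] [DecidableEq C]
    (p : Ω → ℝ) (X : Ω → A) (Z : Ω → C) (z : C) :
    ∑ x, distOf p (fun ω => (X ω, Z ω)) (x, z) = distOf p Z z := by
  simp only [distOf_eq_sum_ite]
  rw [Finset.sum_comm]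
  simp [Prod.ext_iff, ite_and]

theorem sum_distOf {Ω A : Type*} [Fintype Ω] [Fintype A] [DecidableEq A]
    (p : Ω → ℝ) (X : Ω → A) : ∑ a, distOf p X a = ∑ ω, p ω := by
  simpa using (sum_mul_comp_eq_sum_distOf p X fun _ => 1).symm

/-- Entropy as the expectation of the self-information. -/
theorem ent_eq_neg_sum {Ω A : Type*} [Fintype Ω] [Fintype A] [DecidableEq A]
    (p : Ω → ℝ) (X : Ω → A) :
    ent p X = -∑ ω, p ω * Real.log (distOf p X (X ω)) := by
  rw [sum_mul_comp_eq_sum_distOf p X fun a => Real.log (distOf p X a), ent,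
    ← Finset.sum_neg_distrib]
  simp [Real.negMulLog]

/-- Entropy only depends on the partition of the sample space. -/
theorem ent_congr {Ω A B : Type*} [Fintype Ω] [Fintype A] [Fintype B]
    [DecidableEq A] [DecidableEq B] (p : Ω → ℝ) {X : Ω → A} {Y : Ω → B}
    (h : ∀ ω ω', X ω = X ω' ↔ Y ω = Y ω') : ent p X = ent p Y := by
  simp only [ent_eq_neg_sum, distOf, h]

theorem ent_unit {Ω : Type*} [Fintype Ω] {p : Ω → ℝ} (hp : IsPMF p) :
    ent p (fun _ : Ω => ()) = 0 := by
  simp [ent, distOf, hp.2]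

theorem ent_submodular {Ω A B C : Type*} [Fintype Ω] [Fintype A] [Fintype B] [Fintype C]
    [DecidableEq A] [DecidableEq B] [DecidableEq C] {p : Ω → ℝ} (hp : IsPMF p)
    (X : Ω → A) (Y : Ω → B) (Z : Ω → C) :
    ent p (fun ω => (X ω, Y ω, Z ω)) + ent p Z ≤
      ent p (fun ω => (X ω, Z ω)) + ent p (fun ω => (Y ω, Z ω)) := by
  set P := distOf p (fun ω => (X ω, Y ω, Z ω))
  set Q := distOf p Z with hQ
  set R := distOf p (fun ω => (X ω, Z ω)) with hR
  set S := distOf p (fun ω => (Y ω, Z ω)) with hS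
  have hterm : ∀ ω, p ω * (1 - R (X ω, Z ω) * S (Y ω, Z ω) / (P (X ω, Y ω, Z ω) * Q (Z ω))) ≤
      p ω * (Real.log (P (X ω, Y ω, Z ω)) + Real.log (Q (Z ω))
        - Real.log (R (X ω, Z ω)) - Real.log (S (Y ω, Z ω))) := by
    intro ω
    rcases (hp.1 ω).eq_or_lt with h | h
    · simp [← h]
    have h1 : 0 < P (X ω, Y ω, Z ω) := distOf_apply_pos hp.1 (fun ω => (X ω, Y ω, Z ω)) h
    have h2 : 0 < Q (Z ω) := distOf_apply_pos hp.1 Z h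
    have h3 : 0 < R (X ω, Z ω) := distOf_apply_pos hp.1 (fun ω => (X ω, Z ω)) h
    have h4 : 0 < S (Y ω, Z ω) := distOf_apply_pos hp.1 (fun ω => (Y ω, Z ω)) h
    refine mul_le_mul_of_nonneg_left ?_ h.le
    have := Real.log_le_sub_one_of_pos (div_pos (mul_pos h3 h4) (mul_pos h1 h2))
    rw [Real.log_div (by positivity) (by positivity), Real.log_mul h3.ne' h4.ne',
      Real.log_mul h1.ne' h2.ne'] at this
    linarith
  have hsum := Finset.sum_le_sum fun ω (_ : ω ∈ Finset.univ) => hterm ω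
  have hbound : ∑ ω, p ω * (R (X ω, Z ω) * S (Y ω, Z ω) / (P (X ω, Y ω, Z ω) * Q (Z ω))) ≤ 1 := by
    calc _ = ∑ t : A × B × C, P t * (R (t.1, t.2.2) * S (t.2.1, t.2.2) / (P t * Q t.2.2)) :=
          sum_mul_comp_eq_sum_distOf p (fun ω => (X ω, Y ω, Z ω))
            fun t => R (t.1, t.2.2) * S (t.2.1, t.2.2) / (P t * Q t.2.2)
      _ ≤ ∑ t : A × B × C, R (t.1, t.2.2) * S (t.2.1, t.2.2) / Q t.2.2 := by
          refine Finset.sum_le_sum fun t _ => ?_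
          have h2 : 0 ≤ Q t.2.2 := distOf_nonneg hp.1 _ _
          have h3 : 0 ≤ R (t.1, t.2.2) := distOf_nonneg hp.1 _ _
          have h4 : 0 ≤ S (t.2.1, t.2.2) := distOf_nonneg hp.1 _ _
          by_cases h : P t = 0
          · rw [h, zero_mul]
            positivity
          · rw [mul_comm (P t) (Q _), ← div_div, mul_div_cancel₀ _ h]
      _ = ∑ z, (∑ x, R (x, z)) * (∑ y, S (y, z)) / Q z := by
          simp only [Fintype.sum_prod_type, Finset.sum_mul_sum, Finset.sum_div]
          rw [Finset.sum_comm' (t' := Finset.univ) (s' := fun _ => Finset.univ) (by simp)]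
          rw [Finset.sum_comm]
          simp_rw [Finset.sum_comm (s := (Finset.univ : Finset B)) (t := (Finset.univ : Finset C))]
          rw [Finset.sum_comm]
      _ = ∑ z, Q z := by
          refine Finset.sum_congr rfl fun z _ => ?_
          rw [hR, hS, sum_distOf_fst, sum_distOf_fst, ← hQ, mul_self_div_self]
      _ = 1 := (sum_distOf p Z).trans hp.2
  simp only [mul_sub, mul_add, Finset.sum_sub_distrib, Finset.sum_add_distrib, mul_one, hp.2]
    at hsum
  simp only [ent_eq_neg_sum]
  linarith

theorem MarkovTriple.ent_add_ent {Ω A B C : Type*} [Fintype Ω] [Fintype A] [Fintype B] [Fintype C]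
    [DecidableEq A] [DecidableEq B] [DecidableEq C] {p : Ω → ℝ} (hp : ∀ ω, 0 ≤ p ω)
    {X : Ω → A} {Y : Ω → B} {Z : Ω → C} (h : MarkovTriple p X Y Z) :
    ent p (fun ω => (X ω, Y ω, Z ω)) + ent p Z =
      ent p (fun ω => (X ω, Z ω)) + ent p (fun ω => (Y ω, Z ω)) := by
  simp only [ent_eq_neg_sum, ← neg_add, ← Finset.sum_add_distrib, ← mul_add]
  congr 1
  refine Finset.sum_congr rfl fun ω _ => ?_
  rcases (hp ω).eq_or_lt with h0 | h0
  · simp [← h0]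
  have h1 := (distOf_apply_pos hp (fun ω => (X ω, Y ω, Z ω)) h0).ne'
  have h2 := (distOf_apply_pos hp Z h0).ne'
  have h3 := (distOf_apply_pos hp (fun ω => (X ω, Z ω)) h0).ne'
  have h4 := (distOf_apply_pos hp (fun ω => (Y ω, Z ω)) h0).ne'
  rw [← Real.log_mul h1 h2, ← Real.log_mul h3 h4, h]

theorem condEnt_nonneg {Ω A B : Type*} [Fintype Ω] [Fintype A] [Fintype B]
    [DecidableEq A] [DecidableEq B] {p : Ω → ℝ} (hp : IsPMF p) (X : Ω → A) (Y : Ω → B) :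
    0 ≤ condEnt p X Y := by
  have h := ent_submodular hp X X Y
  have h' : ent p (fun ω => (X ω, X ω, Y ω)) = ent p (fun ω => (X ω, Y ω)) :=
    ent_congr p (by simp)
  rw [condEnt]
  linarith

theorem mutInfo_nonneg {Ω A B : Type*} [Fintype Ω] [Fintype A] [Fintype B]
    [DecidableEq A] [DecidableEq B] {p : Ω → ℝ} (hp : IsPMF p) (X : Ω → A) (Y : Ω → B) :
    0 ≤ mutInfo p X Y := by
  have h := ent_submodular hp X Y fun _ => ()
  have hXY : ent p (fun ω => (X ω, Y ω, ())) = ent p (fun ω => (X ω, Y ω)) :=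
    ent_congr p (by simp)
  have hX : ent p (fun ω => (X ω, ())) = ent p X := ent_congr p (by simp)
  have hY : ent p (fun ω => (Y ω, ())) = ent p Y := ent_congr p (by simp)
  rw [mutInfo]
  linarith [ent_unit hp]

theorem stmt9 {Ω A B C : Type*} [Fintype Ω] [Fintype A] [Fintype B] [Fintype C]
    [DecidableEq A] [DecidableEq B] [DecidableEq C]
    (p : Ω → ℝ) (hp : IsPMF p)
    (X1 : Ω → A) (X2 : Ω → B) (U : Ω → C)
    (hMarkov : MarkovTriple p X1 X2 U)
    (K : ℕ) (hK : 2 ≤ K)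
    (ρ0 ρ1 ρ2 γK : ℝ)
    (hρ0 : ρ0 = mutInfo p (fun ω => (X1 ω, X2 ω)) U)
    (hρ1 : ρ1 = condEnt p X1 U)
    (hρ2 : ρ2 = condEnt p X2 U)
    (hγ : γK = (1 / (K : ℝ)) * min ρ1 ρ2)
    (RMR Rlb : ℝ → ℝ)
    (hRMR : ∀ M, RMR M =
      if M < γK then ρ0 + ρ1 + ρ2 - 2 * M
      else if M < ρ0 + ρ1 + ρ2 - 2 * γK then ρ0 + ρ1 + ρ2 - γK - M
      else (1/2) * (ρ0 + ρ1 + ρ2 - M))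
    (hRlb : ∀ M, Rlb M =
      max (ent p (fun ω => (X1 ω, X2 ω)) - 2 * M)
        (max ((1/2) * (ent p (fun ω => (X1 ω, X2 ω)) + max (ent p X1) (ent p X2)) - M)
             ((1/2) * (ent p (fun ω => (X1 ω, X2 ω)) - M)))) :
    (∀ M ∈ Set.Icc (0:ℝ) γK ∪
        Set.Icc (ent p (fun ω => (X1 ω, X2 ω)) - 2 * γK) (ent p (fun ω => (X1 ω, X2 ω))),
      RMR M = Rlb M) ∧
    (∀ M ∈ Set.Icc (0:ℝ) (ent p (fun ω => (X1 ω, X2 ω))),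
      RMR M - Rlb M ≤
        (1/2) * min (condEnt p X1 X2) (condEnt p X2 X1)
          - (1 / (K : ℝ)) * min (condEnt p X1 U) (condEnt p X2 U)) := by
  have hX12 : ent p (fun ω => (X2 ω, X1 ω)) = ent p (fun ω => (X1 ω, X2 ω)) :=
    ent_congr p (by simp [and_comm])
  have hassoc : ent p (fun ω => ((X1 ω, X2 ω), U ω)) = ent p (fun ω => (X1 ω, X2 ω, U ω)) :=
    ent_congr p (by simp [and_assoc])
  have hM := hMarkov.ent_add_ent hp.1
  have hsub1 : ent p (fun ω => (X1 ω, X2 ω, U ω)) + ent p X2 ≤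
      ent p (fun ω => (X1 ω, X2 ω)) + ent p (fun ω => (X2 ω, U ω)) := by
    have h := ent_submodular hp X1 U X2
    rwa [ent_congr p (Y := fun ω => (X1 ω, X2 ω, U ω)) (by simp [and_comm]),
      ent_congr p (X := fun ω => (U ω, X2 ω)) (Y := fun ω => (X2 ω, U ω))
        (by simp [and_comm])] at h
  have hsub2 : ent p (fun ω => (X1 ω, X2 ω, U ω)) + ent p X1 ≤
      ent p (fun ω => (X1 ω, X2 ω)) + ent p (fun ω => (X1 ω, U ω)) := by
    have h := ent_submodular hp X2 U X1
    rwa [ent_congr p (Y := fun ω => (X1 ω, X2 ω, U ω)) (by simp; tauto),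
      ent_congr p (X := fun ω => (U ω, X1 ω)) (Y := fun ω => (X1 ω, U ω))
        (by simp [and_comm]), hX12] at h
  have hρ0_nonneg : 0 ≤ ρ0 := hρ0 ▸ mutInfo_nonneg hp _ _
  have hρ1_nonneg : 0 ≤ ρ1 := hρ1 ▸ condEnt_nonneg hp _ _
  have hρ2_nonneg : 0 ≤ ρ2 := hρ2 ▸ condEnt_nonneg hp _ _
  rw [← hρ1, ← hρ2, ← hγ]
  have hm : 0 ≤ min ρ1 ρ2 := le_min hρ1_nonneg hρ2_nonneg
  have hK' : (1 / (K : ℝ)) ≤ 1 / 2 :=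
    one_div_le_one_div_of_le two_pos (by exact_mod_cast hK)
  have hγ_nonneg : 0 ≤ γK := hγ ▸ by positivity
  have hγ_le : γK ≤ 1 / 2 * min ρ1 ρ2 := hγ ▸ mul_le_mul_of_nonneg_right hK' hm
  have hm1 := min_le_left ρ1 ρ2
  have hm2 := min_le_right ρ1 ρ2
  simp only [condEnt, mutInfo] at hρ0 hρ1 hρ2 ⊢
  rw [hX12]
  set H := ent p (fun ω => (X1 ω, X2 ω))
  have hH : ρ0 + ρ1 + ρ2 = H := by linarith
  have hgap : min (H - ent p X2) (H - ent p X1) = H - max (ent p X1) (ent p X2) := by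
    rw [min_sub_sub_left, max_comm]
  have hmax : max (ent p X1) (ent p X2) ≤ H - 2 * γK := max_le (by linarith) (by linarith)
  rw [hgap]
  set m := max (ent p X1) (ent p X2)
  rw [hH] at hRMR
  have hlow : ∀ M ∈ Set.Icc (0 : ℝ) γK, RMR M = Rlb M := by
    rintro M ⟨hM0, hMγ⟩
    have hR : RMR M = H - 2 * M := by
      rw [hRMR]
      split_ifs <;> linarith
    rw [hR, hRlb, max_eq_left (max_le (by linarith) (by linarith))]
  have hhigh : ∀ M ∈ Set.Icc (H - 2 * γK) H, RMR M = Rlb M := by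
    rintro M ⟨hM0, hMH⟩
    have hR : RMR M = 1 / 2 * (H - M) := by
      rw [hRMR]
      split_ifs <;> linarith
    rw [hR, hRlb, max_eq_right (a := 1 / 2 * (H + m) - M) (by linarith),
      max_eq_right (by linarith)]
  refine ⟨fun M hMem => hMem.elim (hlow M) (hhigh M), ?_⟩
  rintro M ⟨hM0, hMH⟩
  by_cases h1 : M < γK
  · rw [hlow M ⟨hM0, h1.le⟩]
    linarith
  by_cases h2 : M < H - 2 * γK
  · have hlb : 1 / 2 * (H + m) - M ≤ Rlb M := by
      rw [hRlb]
      exact (le_max_left _ _).trans (le_max_right _ _)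
    rw [hRMR, if_neg h1, if_pos h2]
    linarith
  · rw [hhigh M ⟨not_lt.1 h2, hMH⟩]
    linarith
end

section
/- Let ρ0, ρ1, ρ2 ≥ 0 be reals and K ≥ 2 an integer; set γ = (1/K)·min{ρ1,ρ2} and L = ρ1 + ρ2. Define f(μ) on [0, L] by: f(μ) = L − 2μ for μ ∈ [0, γ); f(μ) = L − γ − μ for μ ∈ [γ, L − 2γ); f(μ) = (1/2)(L − μ) for μ ∈ [L − 2γ, L]. Then for every M ∈ [0, ρ0 + L], the minimum of ρ0 − μ0 + f(μ) over all pairs (μ0, μ) with μ0 + μ ≤ M, 0 ≤ μ0 ≤ ρ0, and 0 ≤ μ ≤ L equals: ρ0 + L − 2M if M ∈ [0, γ); ρ0 + L − γ − M if M ∈ [γ, ρ0 + L − 2γ); and (1/2)(ρ0 + L − M) if M ∈ [ρ0 + L − 2γ, ρ0 + L]. -/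
theorem stmt16 (ρ0 ρ1 ρ2 : ℝ) (hρ0 : 0 ≤ ρ0) (hρ1 : 0 ≤ ρ1) (hρ2 : 0 ≤ ρ2)
    (K : ℕ) (hK : 2 ≤ K)
    (γ L : ℝ)
    (hγ : γ = (1 / (K : ℝ)) * min ρ1 ρ2)
    (hL : L = ρ1 + ρ2)
    (f : ℝ → ℝ)
    (hf : ∀ μ, f μ =
      if μ < γ then L - 2 * μ
      else if μ < L - 2 * γ then L - γ - μ
      else (1/2) * (L - μ)) :
    ∀ M ∈ Set.Icc (0:ℝ) (ρ0 + L),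
      IsLeast {r : ℝ | ∃ μ0 μ, μ0 + μ ≤ M ∧ 0 ≤ μ0 ∧ μ0 ≤ ρ0 ∧ 0 ≤ μ ∧ μ ≤ L ∧
          r = ρ0 - μ0 + f μ}
        (if M < γ then ρ0 + L - 2 * M
         else if M < ρ0 + L - 2 * γ then ρ0 + L - γ - M
         else (1/2) * (ρ0 + L - M)) := by
  have hK' : (1 / (K : ℝ)) ≤ 1 / 2 :=
    one_div_le_one_div_of_le (by norm_num) (by exact_mod_cast hK)
  have hmin : 0 ≤ min ρ1 ρ2 := le_min hρ1 hρ2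
  have hγ0 : 0 ≤ γ := by rw [hγ]; positivity
  have hγmin : γ ≤ 1 / 2 * min ρ1 ρ2 := by
    rw [hγ]; exact mul_le_mul_of_nonneg_right hK' hmin
  have hγL : 4 * γ ≤ L := by
    linarith [min_le_left ρ1 ρ2, min_le_right ρ1 ρ2]
  rintro M ⟨hM0, hM⟩
  constructor
  · by_cases hMγ : M < γ
    · refine ⟨0, M, by linarith, le_rfl, hρ0, hM0, by linarith, ?_⟩
      rw [hf, if_pos hMγ, if_pos hMγ]
      ring
    · rcases le_total M (ρ0 + γ) with h | h
      · refine ⟨M - γ, γ, by linarith, by linarith, by linarith, hγ0, by linarith, ?_⟩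
        rw [hf]
        split_ifs <;> linarith
      · refine ⟨ρ0, M - ρ0, by linarith, hρ0, le_rfl, by linarith, by linarith, ?_⟩
        rw [hf]
        split_ifs <;> linarith
  · rintro r ⟨μ0, μ, hsum, hμ0, hμ0ρ, hμ, hμL, rfl⟩
    rw [hf]
    split_ifs <;> linarith
end

section
/- Let ρ0, ρ', ρ ≥ 0 be reals. Define R_L2(μ') on [0, 3ρ'] by: R_L2(μ') = 3ρ' − 2μ' for μ' ∈ [0, (1/2)ρ'); R_L2(μ') = (5/2)ρ' − μ' for μ' ∈ [(1/2)ρ', (3/2)ρ'); R_L2(μ') = 2ρ' − (2/3)μ' for μ' ∈ [(3/2)ρ', 3ρ']; and define R_L1(μ) on [0, 3ρ] by: R_L1(μ) = 2ρ − μ for μ ∈ [0, (3/2)ρ); R_L1(μ) = ρ − (1/3)μ for μ ∈ [(3/2)ρ, 3ρ]. Then for every M ∈ [0, ρ0 + 3ρ' + 3ρ], the minimum of ρ0 − μ0 + R_L2(μ') + R_L1(μ) over all triples (μ0, μ', μ) with μ0 + μ' + μ ≤ M, 0 ≤ μ0 ≤ ρ0, 0 ≤ μ' ≤ 3ρ',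 and 0 ≤ μ ≤ 3ρ equals: ρ0 + 3ρ' + 2ρ − 2M if M ∈ [0, (1/2)ρ'); ρ0 + (5/2)ρ' + 2ρ − M if M ∈ [(1/2)ρ', ρ0 + (3/2)(ρ'+ρ)); (2/3)ρ0 + 2ρ' + (3/2)ρ − (2/3)M if M ∈ [ρ0 + (3/2)(ρ'+ρ), ρ0 + 3ρ' + (3/2)ρ); and (1/3)ρ0 + ρ' + ρ − (1/3)M if M ∈ [ρ0 + 3ρ' + (3/2)ρ, ρ0 + 3ρ' + 3ρ]. -/
theorem stmt17 (ρ0 ρ' ρ : ℝ) (hρ0 : 0 ≤ ρ0) (hρ' : 0 ≤ ρ') (hρ : 0 ≤ ρ)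
    (RL2 RL1 : ℝ → ℝ)
    (hRL2 : ∀ μ', RL2 μ' =
      if μ' < (1/2) * ρ' then 3 * ρ' - 2 * μ'
      else if μ' < (3/2) * ρ' then (5/2) * ρ' - μ'
      else 2 * ρ' - (2/3) * μ')
    (hRL1 : ∀ μ, RL1 μ =
      if μ < (3/2) * ρ then 2 * ρ - μ
      else ρ - (1/3) * μ) :
    ∀ M ∈ Set.Icc (0:ℝ) (ρ0 + 3 * ρ' + 3 * ρ),
      IsLeast {r : ℝ | ∃ μ0 μ' μ, μ0 + μ' + μ ≤ M ∧ 0 ≤ μ0 ∧ μ0 ≤ ρ0 ∧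
          0 ≤ μ' ∧ μ' ≤ 3 * ρ' ∧ 0 ≤ μ ∧ μ ≤ 3 * ρ ∧
          r = ρ0 - μ0 + RL2 μ' + RL1 μ}
        (if M < (1/2) * ρ' then ρ0 + 3 * ρ' + 2 * ρ - 2 * M
         else if M < ρ0 + (3/2) * (ρ' + ρ) then ρ0 + (5/2) * ρ' + 2 * ρ - M
         else if M < ρ0 + 3 * ρ' + (3/2) * ρ then (2/3) * ρ0 + 2 * ρ' + (3/2) * ρ - (2/3) * M
         else (1/3) * ρ0 + ρ' + ρ - (1/3) * M) := by
  have a1 : ∀ x, x ≤ (1/2) * ρ' → RL2 x = 3 * ρ' - 2 * x := by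
    intro x hx
    rw [hRL2]
    split_ifs <;> linarith
  have a2 : ∀ x, (1/2) * ρ' ≤ x → x ≤ (3/2) * ρ' → RL2 x = (5/2) * ρ' - x := by
    intro x hx hx'
    rw [hRL2]
    split_ifs <;> linarith
  have a3 : ∀ x, (3/2) * ρ' ≤ x → RL2 x = 2 * ρ' - (2/3) * x := by
    intro x hx
    rw [hRL2]
    split_ifs <;> linarith
  have b1 : ∀ x, x ≤ (3/2) * ρ → RL1 x = 2 * ρ - x := by
    intro x hx
    rw [hRL1]
    split_ifs <;> linarith
  have b2 : ∀ x, (3/2) * ρ ≤ x → RL1 x = ρ - (1/3) * x := by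
    intro x hx
    rw [hRL1]
    split_ifs <;> linarith
  have a_le : ∀ x, 3 * ρ' - 2 * x ≤ RL2 x ∧ (5/2) * ρ' - x ≤ RL2 x ∧
      2 * ρ' - (2/3) * x ≤ RL2 x := by
    intro x
    rw [hRL2]
    split_ifs <;> refine ⟨?_, ?_, ?_⟩ <;> linarith
  have b_le : ∀ x, 2 * ρ - x ≤ RL1 x ∧ ρ - (1/3) * x ≤ RL1 x := by
    intro x
    rw [hRL1]
    split_ifs <;> constructor <;> linarith
  clear hRL2 hRL1
  rintro M ⟨hM0, hM⟩
  constructor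
  · rcases lt_or_ge M ((1/2) * ρ') with h0 | h0
    · refine ⟨0, M, 0, by linarith, by linarith, by linarith, by linarith, by linarith,
        by linarith, by linarith, ?_⟩
      rw [a1 _ (by linarith), b1 _ (by linarith), if_pos h0]
      ring
    rw [if_neg (not_lt.mpr h0)]
    rcases lt_or_ge M ((3/2) * ρ') with h1 | h1
    · refine ⟨0, M, 0, by linarith, by linarith, by linarith, by linarith, by linarith,
        by linarith, by linarith, ?_⟩
      rw [a2 _ (by linarith) (by linarith), b1 _ (by linarith), if_pos (by linarith)]
      ring
    rcases lt_or_ge M (ρ0 + (3/2) * (ρ' + ρ)) with h3 | h3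
    · rw [if_pos h3]
      rcases lt_or_ge M (ρ0 + (3/2) * ρ') with h2 | h2
      · refine ⟨M - (3/2) * ρ', (3/2) * ρ', 0, by linarith, by linarith, by linarith,
          by linarith, by linarith, by linarith, by linarith, ?_⟩
        rw [a2 _ (by linarith) (by linarith), b1 _ (by linarith)]
        ring
      · refine ⟨ρ0, (3/2) * ρ', M - ρ0 - (3/2) * ρ', by linarith, by linarith, by linarith,
          by linarith, by linarith, by linarith, by linarith, ?_⟩
        rw [a2 _ (by linarith) (by linarith), b1 _ (by linarith)]
        ring
    rw [if_neg (not_lt.mpr h3)]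
    rcases lt_or_ge M (ρ0 + 3 * ρ' + (3/2) * ρ) with h4 | h4
    · refine ⟨ρ0, M - ρ0 - (3/2) * ρ, (3/2) * ρ, by linarith, by linarith, by linarith,
        by linarith, by linarith, by linarith, by linarith, ?_⟩
      rw [a3 _ (by linarith), b1 _ (by linarith), if_pos h4]
      ring
    · refine ⟨ρ0, 3 * ρ', M - ρ0 - 3 * ρ', by linarith, by linarith, by linarith,
        by linarith, by linarith, by linarith, by linarith, ?_⟩
      rw [a3 _ (by linarith), b2 _ (by linarith), if_neg (not_lt.mpr h4)]
      ring
  · rintro r ⟨μ0, μ', μ, hs, h0, h0', h1, h1', h2, h2', rfl⟩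
    obtain ⟨ha1, ha2, ha3⟩ := a_le μ'
    obtain ⟨hb1, hb2⟩ := b_le μ
    split_ifs <;> linarith
end

section
/- Let ρ0, ρ1, ρ2 ≥ 0 be reals and K ≥ 2 an integer; set γ = (1/K)·min{ρ1,ρ2} and L = ρ1 + ρ2. Define f̄(μ) on [0, L] by: f̄(μ) = (1 − 1/2^K)L − (3/2 − 2/2^K)μ for μ ∈ [0, 2γ); f̄(μ) = (1 − 1/2^K)(L − μ) − (1 − 2/2^K)γ for μ ∈ [2γ, L − 2γ); f̄(μ) = (1/2)(L − μ) for μ ∈ [L − 2γ, L]. Then for every M ∈ [0, ρ0 + L], the minimum of ρ0 − μ0 + f̄(μ) over all pairs (μ0, μ) with μ0 + μ ≤ M, 0 ≤ μ0 ≤ ρ0, and 0 ≤ μ ≤ L equals: ρ0 + (1 − 1/2^K)L − (3/2 − 2/2^K)M if M ∈ [0, 2γ); ρ0 + (1 − 1/2^K)L − (1 − 4/2^K)γ − M if M ∈ [2γ, ρ0 + 2γ); (1 − 1/2^K)(ρ0 + L − M) − (1 − 2/2^K)γ if M ∈ [ρ0 + 2γ, ρ0 + L − 2γ); and (1/2)(ρ0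 + L − M) if M ∈ [ρ0 + L − 2γ, ρ0 + L]. -/
theorem stmt19 (ρ0 ρ1 ρ2 : ℝ) (hρ0 : 0 ≤ ρ0) (hρ1 : 0 ≤ ρ1) (hρ2 : 0 ≤ ρ2)
    (K : ℕ) (hK : 2 ≤ K)
    (γ L : ℝ)
    (hγ : γ = (1 / (K : ℝ)) * min ρ1 ρ2)
    (hL : L = ρ1 + ρ2)
    (fbar : ℝ → ℝ)
    (hfbar : ∀ μ, fbar μ =
      if μ < 2 * γ then (1 - 1/(2:ℝ)^K) * L - (3/2 - 2/(2:ℝ)^K) * μ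
      else if μ < L - 2 * γ then (1 - 1/(2:ℝ)^K) * (L - μ) - (1 - 2/(2:ℝ)^K) * γ
      else (1/2) * (L - μ)) :
    ∀ M ∈ Set.Icc (0:ℝ) (ρ0 + L),
      IsLeast {r : ℝ | ∃ μ0 μ, μ0 + μ ≤ M ∧ 0 ≤ μ0 ∧ μ0 ≤ ρ0 ∧ 0 ≤ μ ∧ μ ≤ L ∧
          r = ρ0 - μ0 + fbar μ}
        (if M < 2 * γ then ρ0 + (1 - 1/(2:ℝ)^K) * L - (3/2 - 2/(2:ℝ)^K) * M
         else if M < ρ0 + 2 * γ then ρ0 + (1 - 1/(2:ℝ)^K) * L - (1 - 4/(2:ℝ)^K) * γ - M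
         else if M < ρ0 + L - 2 * γ then (1 - 1/(2:ℝ)^K) * (ρ0 + L - M) - (1 - 2/(2:ℝ)^K) * γ
         else (1/2) * (ρ0 + L - M)) := by
  rintro M ⟨hM0, hML⟩
  obtain ⟨t, ht⟩ : ∃ t : ℝ, t = 1 / (2 : ℝ) ^ K := ⟨_, rfl⟩
  have ht0 : 0 ≤ t := by rw [ht]; positivity
  have ht4 : t ≤ 1 / 4 := by
    rw [ht]
    apply one_div_le_one_div_of_le (by norm_num)
    calc (4 : ℝ) = 2 ^ 2 := by norm_num
      _ ≤ 2 ^ K := pow_le_pow_right₀ (by norm_num) hK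
  have ht2 : 2 / (2 : ℝ) ^ K = 2 * t := by rw [ht]; ring
  have ht4' : 4 / (2 : ℝ) ^ K = 4 * t := by rw [ht]; ring
  simp only [ht2, ht4', ← ht] at hfbar ⊢
  have hK' : (2 : ℝ) ≤ K := by exact_mod_cast hK
  have hmin : 0 ≤ min ρ1 ρ2 := le_min hρ1 hρ2
  have hγ0 : 0 ≤ γ := by rw [hγ]; positivity
  have hγL : 4 * γ ≤ L := by
    have hKγ : K * γ = min ρ1 ρ2 := by rw [hγ]; field_simp
    have := mul_le_mul_of_nonneg_right hK' hγ0
    linarith [min_le_left ρ1 ρ2, min_le_right ρ1 ρ2]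
  -- `fbar` dominates each of its three affine pieces, by convexity.
  have hfA : ∀ μ, (1 - t) * L - (3/2 - 2 * t) * μ ≤ fbar μ := by
    intro μ
    rw [hfbar]
    split_ifs with h₁ h₂
    · exact le_rfl
    · nlinarith
    · nlinarith
  have hfB : ∀ μ, (1 - t) * (L - μ) - (1 - 2 * t) * γ ≤ fbar μ := by
    intro μ
    rw [hfbar]
    split_ifs with h₁ h₂
    · nlinarith
    · exact le_rfl
    · nlinarith
  have hfC : ∀ μ, 1/2 * (L - μ) ≤ fbar μ := by
    intro μ
    rw [hfbar]
    split_ifs with h₁ h₂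
    · nlinarith
    · nlinarith
    · exact le_rfl
  have hf2γ : fbar (2 * γ) = (1 - t) * L - (3 - 4 * t) * γ := by
    rw [hfbar]
    split_ifs with h₁ h₂
    · linarith
    · ring
    · obtain rfl : L = 4 * γ := by linarith
      ring
  constructor
  · split_ifs with h₁ h₂ h₃
    · refine ⟨0, M, by linarith, le_rfl, hρ0, hM0, by linarith, ?_⟩
      rw [hfbar, if_pos h₁]; ring
    · refine ⟨M - 2 * γ, 2 * γ, by linarith, by linarith, by linarith, by linarith,
        by linarith, ?_⟩
      rw [hf2γ]; ring
    · refine ⟨ρ0, M - ρ0, by linarith, hρ0, le_rfl, by linarith, by linarith, ?_⟩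
      rw [hfbar, if_neg (by linarith), if_pos (by linarith)]; ring
    · refine ⟨ρ0, M - ρ0, by linarith, hρ0, le_rfl, by linarith, by linarith, ?_⟩
      rw [hfbar, if_neg (by linarith), if_neg (by linarith)]; ring
  · rintro _ ⟨μ0, μ, hsum, hμ0, hμ0ρ, hμ, hμL, rfl⟩
    have hA := hfA μ
    have hB := hfB μ
    have hC := hfC μ
    split_ifs with h₁ h₂ h₃
    · nlinarith [mul_nonneg (by linarith : 0 ≤ 1/2 - 2 * t) (by linarith : 0 ≤ M - μ)]
    · rcases le_total μ (2 * γ) with h | h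
      · nlinarith [mul_nonneg (by linarith : 0 ≤ 1/2 - 2 * t) (sub_nonneg.2 h)]
      · nlinarith [mul_nonneg ht0 (sub_nonneg.2 h)]
    · nlinarith [mul_nonneg ht0 (sub_nonneg.2 hμ0ρ),
        mul_nonneg (by linarith : 0 ≤ 1 - t) (by linarith : 0 ≤ M - μ0 - μ)]
    · linarith
end
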